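/- For all non-negative integers n, j and t with j ≤ n, the Fuss-Catalan number of order three C3(n) = binom(3n,n)/(2n+1) divides M_S(2n,j,t); equivalently, binom(3n,n) divides (2n+1) * M_S(2n,j,t). -/

import Mathlib

/-- Catalan triangle number `C(N,k) = binom(N+k,N) - binom(N+k,N+1)`. -/
def catT (N k : ℕ) : ℤ := ((N + k).choose N : ℤ) - ((N + k).choose (N + 1) : ℤ)

/-- `F(2n,k) = (-1)^k C(2n,k) C(2n,2n-k)`. -/
def F (n k : ℕ) : ℤ := (-1) ^ k * catT (2 * n) k * catT (2 * n) (2 * n - k)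

/-- The M sum
`M_S(2n,j,t) = binom(2n-j,j) * Σ_{v=0}^{2n-2j} binom(2n-2j,v) binom(2n,j+v)^t F(2n,j+v)`. -/
def MS (n j t : ℕ) : ℤ :=
  ((2 * n - j).choose j : ℤ) *
    ∑ v ∈ Finset.range (2 * n - 2 * j + 1),
      ((2 * n - 2 * j).choose v : ℤ) * ((2 * n).choose (j + v) : ℤ) ^ t * F n (j + v)

open Finset in
theorem sum_choose_mul_choose_eq (n j k : ℕ) (hj : j ≤ k) (hk : k + j ≤ 2 * n) :
    ∑ u ∈ range (n - j + 1), k.choose (j + u) * (2 * n - j - k).choose u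
      = (2 * n - j).choose (k - j) := by
  have h : ∑ u ∈ range (k - j + 1), k.choose (j + u) * (2 * n - j - k).choose u
      = (2 * n - j).choose (k - j) := by
    rw [show 2 * n - j = (2 * n - j - k) + k by omega, Nat.add_choose_eq,
      Nat.sum_antidiagonal_eq_sum_range_succ_mk]
    refine sum_congr rfl fun u hu => ?_
    rw [mem_range] at hu
    rw [Nat.add_sub_cancel, mul_comm, ← Nat.choose_symm (show j + u ≤ k by omega),
      show k - (j + u) = k - j - u by omega]
  rw [← h]
  rcases le_total k n with hkn | hkn
  · refine (sum_subset (range_mono (by omega)) fun u _ hu => ?_).symm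
    rw [mem_range] at hu
    rw [Nat.choose_eq_zero_of_lt (show k < j + u by omega), zero_mul]
  · refine sum_subset (range_mono (by omega)) fun u _ hu => ?_
    rw [mem_range] at hu
    rw [Nat.choose_eq_zero_of_lt (show 2 * n - j - k < u by omega), mul_zero]

/-- `binom(N-2j, k-j)`, extended by zero to `k < j`. -/
def shiftedChoose (N j k : ℕ) : ℕ := if j ≤ k then (N - 2 * j).choose (k - j) else 0

theorem choose_mul_shiftedChoose (n j u k : ℕ) (hk : k + j ≤ 2 * n) (hu : j + u ≤ n) :
    (2 * n - j).choose u * ((2 * n - (j + u)).choose (j + u) * shiftedChoose (2 * n) (j + u) k)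
      = (2 * n - j).choose k * (k.choose (j + u) * (2 * n - j - k).choose u) := by
  unfold shiftedChoose
  split_ifs with h
  · rw [show 2 * n - 2 * (j + u) = 2 * n - (j + u) - (j + u) by omega,
      ← Nat.choose_mul h, mul_left_comm, ← mul_assoc,
      mul_comm ((2 * n - (j + u)).choose k), ← Nat.sub_sub (2 * n) j u]
    have h2 : (2 * n - j).choose u * (2 * n - j - u).choose k
        = (2 * n - j).choose k * (2 * n - j - k).choose u := by
      rcases le_or_gt (u + k) (2 * n - j) with hle | hlt
      · have e1 := Nat.choose_mul (n := 2 * n - j) (k := u + k) (s := u) (by omega)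
        have e2 := Nat.choose_mul (n := 2 * n - j) (k := u + k) (s := k) (by omega)
        rw [Nat.add_sub_cancel_left] at e1
        rw [Nat.add_sub_cancel] at e2
        rw [← e1, ← e2, Nat.choose_symm_add]
      · rw [Nat.choose_eq_zero_of_lt (show 2 * n - j - u < k by omega),
          Nat.choose_eq_zero_of_lt (show 2 * n - j - k < u by omega), mul_zero, mul_zero]
    linear_combination (k.choose (j + u)) * h2
  · rw [Nat.choose_eq_zero_of_lt (show k < j + u by omega)]
    simp

open Finset in
theorem choose_mul_shiftedChoose_mul_choose (n j k : ℕ) (hj : j ≤ n) :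
    (2 * n - j).choose j * shiftedChoose (2 * n) j k * (2 * n).choose k
      = (2 * n).choose j * ∑ u ∈ range (n - j + 1), (2 * n - j).choose u *
          ((2 * n - (j + u)).choose (j + u) * shiftedChoose (2 * n) (j + u) k) := by
  rcases le_or_gt (k + j) (2 * n) with hk | hk
  · rw [sum_congr rfl fun u hu => choose_mul_shiftedChoose n j u k hk
      (by rw [mem_range] at hu; omega), ← mul_sum]
    rcases le_or_gt j k with hjk | hjk
    · rw [sum_choose_mul_choose_eq n j k hjk hk, shiftedChoose, if_pos hjk,
        show 2 * n - 2 * j = 2 * n - j - j by omega, ← Nat.choose_mul hjk]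
      linear_combination ((2 * n - j).choose k) * Nat.choose_mul (n := 2 * n) hjk
    · rw [sum_eq_zero fun u _ => by
        rw [Nat.choose_eq_zero_of_lt (show k < j + u by omega), zero_mul]]
      simp [shiftedChoose, show ¬ j ≤ k by omega]
  · have h0 (u : ℕ) (hu : j + u ≤ n) : shiftedChoose (2 * n) (j + u) k = 0 := by
      unfold shiftedChoose
      split_ifs
      · exact Nat.choose_eq_zero_of_lt (by omega)
      · rfl
    rw [sum_eq_zero fun u hu => by
      rw [mem_range] at hu
      rw [h0 u (by omega), mul_zero, mul_zero], show shiftedChoose (2 * n) j k = 0 from h0 0 hj]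
    simp

open Finset in
theorem sum_choose_mul_eq_sum_shiftedChoose (n j : ℕ) (hj : j ≤ n) (G : ℕ → ℤ) :
    ∑ v ∈ range (2 * n - 2 * j + 1), ((2 * n - 2 * j).choose v : ℤ) * G (j + v)
      = ∑ k ∈ range (2 * n + 1), (shiftedChoose (2 * n) j k : ℤ) * G k := by
  conv_rhs =>
    rw [show 2 * n + 1 = j + (2 * n - 2 * j + 1) + j by omega, sum_range_add, sum_range_add]
  rw [sum_eq_zero (s := range j) (f := fun k => _ * G k) fun k hk => ?_,
    sum_eq_zero (s := range j) (f := fun v => _ * G (_ + v)) fun v _ => ?_, zero_add, add_zero]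
  · simp [shiftedChoose]
  · rw [shiftedChoose, if_pos (by omega), Nat.choose_eq_zero_of_lt (by omega)]
    simp
  · rw [mem_range] at hk
    simp [shiftedChoose, show ¬ j ≤ k by omega]

open Finset in
theorem MS_eq_sum_shiftedChoose (n j t : ℕ) (hj : j ≤ n) :
    MS n j t = ∑ k ∈ range (2 * n + 1),
      ((2 * n - j).choose j * shiftedChoose (2 * n) j k : ℤ) *
        (((2 * n).choose k : ℤ) ^ t * F n k) := by
  have h := sum_choose_mul_eq_sum_shiftedChoose n j hj
    fun k => ((2 * n).choose k : ℤ) ^ t * F n k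
  simp only [MS, mul_assoc, ← mul_sum] at h ⊢
  rw [h]

open Finset in
theorem MS_succ (n j t : ℕ) (hj : j ≤ n) :
    MS n j (t + 1) = ((2 * n).choose j : ℤ) *
      ∑ u ∈ range (n - j + 1), ((2 * n - j).choose u : ℤ) * MS n (j + u) t := by
  rw [sum_congr rfl fun u hu => by
    rw [MS_eq_sum_shiftedChoose n (j + u) t (by rw [mem_range] at hu; omega), mul_sum],
    sum_comm, mul_sum, MS_eq_sum_shiftedChoose n j (t + 1) hj]
  refine sum_congr rfl fun k _ => ?_
  have h : ((2 * n - j).choose j * shiftedChoose (2 * n) j k * (2 * n).choose k : ℤ)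
      = (2 * n).choose j * ∑ u ∈ range (n - j + 1), ((2 * n - j).choose u : ℤ) *
          ((2 * n - (j + u)).choose (j + u) * shiftedChoose (2 * n) (j + u) k) := by
    exact_mod_cast choose_mul_shiftedChoose_mul_choose n j k hj
  simp only [← mul_assoc, ← sum_mul] at h ⊢
  rw [← h]
  ring

/-- `binom(2n+k, 2n+c) binom(4n-k, 2n+c)`. -/
def chooseProd (n c k : ℕ) : ℤ := (2 * n + k).choose (2 * n + c) * (4 * n - k).choose (2 * n + c)

/-- The Dixon sum `Σ_v (-1)^(j+v) binom(2n-2j, v) chooseProd n c (j+v)`. -/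
def dixonSum (n c j : ℕ) : ℤ :=
  ∑ v ∈ Finset.range (2 * n - 2 * j + 1),
    ((2 * n - 2 * j).choose v : ℤ) * ((-1) ^ (j + v) * chooseProd n c (j + v))

theorem choose_succ_left_mul (a b : ℕ) :
    ((a + 1).choose b : ℤ) * (a + 1 - b) = (a + 1) * a.choose b := by
  rcases le_or_gt b (a + 1) with h | h
  · have := Nat.choose_mul_succ_eq a b
    zify [h] at this
    linear_combination -this
  · rw [Nat.choose_eq_zero_of_lt h, Nat.choose_eq_zero_of_lt (by omega)]
    simp

theorem choose_succ_right_mul (a b : ℕ) :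
    (a.choose (b + 1) : ℤ) * (b + 1) = a.choose b * (a - b) := by
  rcases le_or_gt b a with h | h
  · have := Nat.choose_succ_right_eq a b
    zify [h] at this
    exact this
  · rw [Nat.choose_eq_zero_of_lt h, Nat.choose_eq_zero_of_lt (by omega)]
    simp

theorem chooseProd_succ (n c k : ℕ) (hk : k < 4 * n) :
    chooseProd n c (k + 1) * ((k + 1 - c) * (4 * n - k))
      = chooseProd n c k * ((2 * n + k + 1) * (2 * n - c - k)) := by
  obtain ⟨r, hr⟩ : ∃ r, 4 * n = k + r + 1 := ⟨4 * n - k - 1, by omega⟩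
  have h1 := choose_succ_left_mul (2 * n + k) (2 * n + c)
  have h2 := choose_succ_left_mul r (2 * n + c)
  have hr' : (4 * n : ℤ) = k + r + 1 := by exact_mod_cast hr
  simp only [chooseProd, show 4 * n - (k + 1) = r by omega, show 4 * n - k = r + 1 by omega,
    ← add_assoc]
  push_cast at h1 h2 ⊢
  have e1 : ((k : ℤ) + 1 - c) = 2 * n + k + 1 - (2 * n + c) := by ring
  have e2 : (2 * n - c - k : ℤ) = r + 1 - (2 * n + c) := by linear_combination hr'
  have e3 : (4 * n - k : ℤ) = r + 1 := by linear_combination hr'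
  rw [e1, e2, e3]
  linear_combination (r.choose (2 * n + c) : ℤ) * (r + 1) * h1
    - ((2 * n + k).choose (2 * n + c) : ℤ) * (2 * n + k + 1) * h2

open Finset in
theorem dixonSum_succ (n c j : ℕ) (hj : j < n) :
    ((2 * n + j + 1) * (2 * n - c - j)) * dixonSum n c j
      = 2 * (2 * n - 2 * j - 1) * (n + c + j + 1) * dixonSum n c (j + 1) := by
  obtain ⟨M, hM⟩ : ∃ M, 2 * n - 2 * j = M + 2 := ⟨2 * n - 2 * j - 2, by omega⟩
  have hn : (2 * n : ℤ) = 2 * j + M + 2 := by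
    have : 2 * n = 2 * j + M + 2 := by omega
    exact_mod_cast this
  let H : ℕ → ℤ := fun v => (-1) ^ (j + v) * (if v = 0 then 0 else ((M + 1).choose (v - 1) : ℤ))
    * ((j + v - c) * (4 * n + 1 - (j + v)) * chooseProd n c (j + v))
  have hsucc (u : ℕ) (hu : u < M + 3) : H (u + 1) = -((-1) ^ (j + u) * ((M + 1).choose u : ℤ) *
      ((2 * n + (j + u) + 1) * (2 * n - c - (j + u)) * chooseProd n c (j + u))) := by
    have := chooseProd_succ n c (j + u) (by omega)
    simp only [H, Nat.add_eq_zero_iff, one_ne_zero, and_false, if_false, Nat.add_sub_cancel,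
      ← add_assoc, pow_succ]
    push_cast at this ⊢
    linear_combination -(-1) ^ (j + u) * ((M + 1).choose u : ℤ) * this
  have htel : ∑ v ∈ range (M + 3), (H v - H (v + 1)) = 0 := by
    rw [sum_range_sub', hsucc (M + 2) (by omega),
      Nat.choose_eq_zero_of_lt (show M + 1 < M + 2 by omega)]
    simp [H]
  have hsplit : dixonSum n c (j + 1) = ∑ v ∈ range (M + 3),
      (if v = 0 then 0 else (M.choose (v - 1) : ℤ)) *
        ((-1) ^ (j + v) * chooseProd n c (j + v)) := by
    rw [dixonSum, show 2 * n - 2 * (j + 1) = M by omega, sum_range_succ' _ (M + 2),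
      sum_range_succ _ (M + 1)]
    simp [add_assoc, add_comm 1]
  rw [hsplit, dixonSum, hM, mul_sum, mul_sum, ← sub_eq_zero, ← sum_sub_distrib]
  refine Eq.trans (sum_congr rfl fun v hv => ?_) htel
  rw [mem_range] at hv
  rw [hsucc v hv]
  rcases v with _ | u
  · simp [H]
    ring
  · have h1 := choose_succ_right_mul (M + 1) u
    have h2 := choose_succ_left_mul M u
    simp only [H, Nat.add_eq_zero_iff, one_ne_zero, and_false, if_false, Nat.add_sub_cancel,
      Nat.choose_succ_succ' (M + 1) u]
    push_cast at h1 h2 ⊢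
    have hM' : (M : ℤ) = 2 * n - 2 * j - 2 := by linear_combination -hn
    rw [hM'] at h1 h2
    generalize ((M + 1).choose u : ℤ) = P at *
    generalize ((M + 1).choose (u + 1) : ℤ) = Q at *
    generalize (M.choose u : ℤ) = b at *
    linear_combination (-1) ^ (j + (u + 1)) * chooseProd n c (j + (u + 1)) *
      ((2 * j + u + 2 + c) * h1 + (2 * n + 2 + 2 * j + 2 * c) * h2)

theorem choose_sub_mul (n j : ℕ) (hj : j < n) :
    ((2 * n - j).choose j : ℤ) * ((2 * n - 2 * j) * (2 * n - 2 * j - 1))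
      = (2 * n - j) * (j + 1) * (2 * n - (j + 1)).choose (j + 1) := by
  obtain ⟨r, hr⟩ : ∃ r, 2 * n = 2 * j + r + 2 := ⟨2 * n - 2 * j - 2, by omega⟩
  have hr' : (2 * n : ℤ) = 2 * j + r + 2 := by exact_mod_cast hr
  have h1 := choose_succ_left_mul (j + r + 1) j
  have h2 := choose_succ_right_mul (j + r + 1) j
  rw [show 2 * n - j = j + r + 1 + 1 by omega, show 2 * n - (j + 1) = j + r + 1 by omega, hr']
  push_cast at h1 h2 ⊢
  linear_combination (r + 1 : ℤ) * h1 - (j + r + 2 : ℤ) * h2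

theorem choose_mul_dixonSum_succ (n c j : ℕ) (hj : j < n) :
    (2 * n + j + 1) * (2 * n - c - j) * (n - j) * ((2 * n - j).choose j * dixonSum n c j)
      = (n + c + j + 1) * (2 * n - j) * (j + 1) *
        (((2 * n - (j + 1)).choose (j + 1) : ℤ) * dixonSum n c (j + 1)) := by
  have h1 := dixonSum_succ n c j hj
  have h2 := choose_sub_mul n j hj
  have h0 : (2 * (2 * n - 2 * j - 1) : ℤ) ≠ 0 := by omega
  apply mul_left_cancel₀ h0
  linear_combination (2 * n - 2 * j : ℤ) * (2 * n - 2 * j - 1) * (2 * n - j).choose j * h1 +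
    2 * (2 * n - 2 * j - 1) * (n + c + j + 1) * dixonSum n c (j + 1) * h2

theorem dixonSum_self (n c : ℕ) :
    dixonSum n c n = (-1) ^ n * ((3 * n).choose (2 * n + c) : ℤ) ^ 2 := by
  simp [dixonSum, chooseProd, show 2 * n + n = 3 * n by omega, show 4 * n - n = 3 * n by omega]
  ring

theorem choose_three_mul (n : ℕ) : (3 * n).choose (2 * n) = (3 * n).choose n := by
  rw [← Nat.choose_symm (show n ≤ 3 * n by omega), show 3 * n - n = 2 * n by omega]

theorem choose_mul_dixonSum_zero (n j : ℕ) (hj : j ≤ n) :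
    ((2 * n - j).choose j : ℤ) * dixonSum n 0 j
      = (-1) ^ n * (3 * n).choose n * ((2 * n + j).choose n * n.choose j) := by
  induction hj using Nat.decreasingInduction with
  | self =>
    rw [dixonSum_self, add_zero, choose_three_mul, show 2 * n - n = n by omega,
      show 2 * n + n = 3 * n by omega]
    simp
    ring
  | of_succ j hj ih =>
    have h := choose_mul_dixonSum_succ n 0 j hj
    rw [ih] at h
    have h1 := choose_succ_left_mul (2 * n + j) n
    have h2 := choose_succ_right_mul n j
    have h0 : ((2 * n + j + 1) * (2 * n - (0 : ℕ) - j) * (n - j) : ℤ) ≠ 0 := by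
      refine mul_ne_zero (mul_ne_zero ?_ ?_) ?_ <;> omega
    apply mul_left_cancel₀ h0
    rw [h, ← add_assoc]
    push_cast at h1 h2 ⊢
    linear_combination (-1) ^ n * ((3 * n).choose n : ℤ) * (2 * n - j) *
      ((n.choose (j + 1) : ℤ) * (j + 1) * h1 + (2 * n + j + 1) * (2 * n + j).choose n * h2)

theorem choose_mul_dixonSum_one (n j : ℕ) (hj : j ≤ n + 1) :
    (2 * (n + 1 : ℕ) + 1) * (((2 * (n + 1) - j).choose j : ℤ) * dixonSum (n + 1) 1 j)
      = (-1) ^ (n + 1) * (3 * (n + 1)).choose (n + 1) *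
        ((2 * (n + 1 : ℕ) - j) * (2 * (n + 1) + j).choose n * (n + 1).choose j) := by
  induction hj using Nat.decreasingInduction with
  | self =>
    have h1 := choose_succ_right_mul (3 * (n + 1)) (2 * (n + 1))
    have h2 : (3 * (n + 1)).choose (2 * (n + 1) + 1) = (3 * (n + 1)).choose n := by
      rw [← Nat.choose_symm (show n ≤ 3 * (n + 1) by omega)]
      congr 1
      omega
    rw [choose_three_mul, h2] at h1
    rw [dixonSum_self, h2, show 2 * (n + 1) - (n + 1) = n + 1 by omega,
      show 2 * (n + 1) + (n + 1) = 3 * (n + 1) by omega, Nat.choose_self]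
    push_cast at h1 ⊢
    linear_combination (-1) ^ (n + 1) * ((3 * (n + 1)).choose n : ℤ) * h1
  | of_succ j hj ih =>
    have h := choose_mul_dixonSum_succ (n + 1) 1 j hj
    have h1 := choose_succ_left_mul (2 * (n + 1) + j) n
    have h2 := choose_succ_right_mul (n + 1) j
    have h0 : ((2 * (n + 1 : ℕ) + j + 1) * (2 * (n + 1 : ℕ) - (1 : ℕ) - j) * ((n + 1 : ℕ) - j) : ℤ)
        ≠ 0 := by
      refine mul_ne_zero (mul_ne_zero ?_ ?_) ?_ <;> omega
    apply mul_left_cancel₀ h0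
    rw [← add_assoc] at ih
    generalize ((2 * (n + 1) - j).choose j : ℤ) * dixonSum (n + 1) 1 j = D at *
    generalize ((2 * (n + 1) - (j + 1)).choose (j + 1) : ℤ) * dixonSum (n + 1) 1 (j + 1) = D' at *
    push_cast at h h1 h2 ih ⊢
    linear_combination (2 * (n + 1) + 1 : ℤ) * h +
      ((n + 1) + 1 + j + 1 : ℤ) * (2 * (n + 1) - j) * (j + 1) * ih +
      (-1) ^ (n + 1) * ((3 * (n + 1)).choose (n + 1) : ℤ) * (2 * (n + 1) - j) *
        (2 * (n + 1) - j - 1) * (((n + 1).choose (j + 1) : ℤ) * (j + 1) * h1 +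
          (2 * (n + 1) + j + 1) * (2 * (n + 1) + j).choose n * h2)

theorem mul_F (n k : ℕ) (hk : k ≤ 2 * n) :
    (2 * n + 1) * F n k = (-1) ^ k * ((2 * n + 1) * chooseProd n 1 k + chooseProd n 0 k) := by
  have h1 := choose_succ_right_mul (2 * n + k) (2 * n)
  have h2 := choose_succ_right_mul (4 * n - k) (2 * n)
  unfold F catT chooseProd
  rw [show 2 * n + (2 * n - k) = 4 * n - k by omega, add_zero]
  rw [Nat.cast_sub (by omega)] at h2
  push_cast at h1 h2
  linear_combination -(-1) ^ k * (((4 * n - k).choose (2 * n) : ℤ) * h1 +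
    ((2 * n + k).choose (2 * n) : ℤ) * h2)

theorem mul_MS_zero (n j : ℕ) (hj : j ≤ n) :
    (2 * n + 1) * MS n j 0 = (2 * n + 1) * ((2 * n - j).choose j * dixonSum n 1 j) +
      (2 * n - j).choose j * dixonSum n 0 j := by
  simp only [MS, dixonSum, Finset.mul_sum, ← Finset.sum_add_distrib]
  refine Finset.sum_congr rfl fun v hv => ?_
  rw [Finset.mem_range] at hv
  have h := mul_F n (j + v) (by omega)
  linear_combination ((2 * n - j).choose j : ℤ) * (2 * n - 2 * j).choose v * h

theorem stmt16 (n j t : ℕ) (hj : j ≤ n) :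
    (((3 * n).choose n : ℤ)) ∣ (2 * (n : ℤ) + 1) * MS n j t := by
  induction t generalizing j with
  | zero =>
    rcases n with _ | n
    · simp
    · rw [mul_MS_zero _ _ hj, choose_mul_dixonSum_one n j hj, choose_mul_dixonSum_zero _ _ hj]
      exact dvd_add (dvd_mul_of_dvd_left (dvd_mul_left _ _) _)
        (dvd_mul_of_dvd_left (dvd_mul_left _ _) _)
  | succ t ih =>
    rw [MS_succ n j t hj, mul_left_comm, Finset.mul_sum]
    refine dvd_mul_of_dvd_right (Finset.dvd_sum fun u hu => ?_) _
    rw [Finset.mem_range] at hu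
    rw [mul_left_comm]
    exact dvd_mul_of_dvd_right (ih _ (by omega)) _
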